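/- Let Φ be an Orlicz function and let p, q be reals with 1 < p < p_Φ ≤ q_Φ < q < ∞, where p_Φ, q_Φ are the Matuzewska–Orlicz indices of Φ; set θ = 1/p − 1/q. Let Ȳ = (Y₀,Y₁) be a compatible couple of Banach spaces, y ∈ Σ(Ȳ), and let u be a representation of y with respect to Ȳ. Then there exists a constant C, depending only on Φ, p and q, such that ∫₀^∞ Φ(t^{−1/q} j(t^θ, u; Ȳ)) dt ≤ C ∫₀^∞ Φ(t^{−1/p} J(t^θ, u(t^θ); Ȳ)) dt (the inequality holding in [0,∞]). -/

import Mathlib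

open MeasureTheory Filter Set

/-- An Orlicz function: continuous, increasing and convex on `[0,∞)`, vanishing at `0`,
and tending to `∞` at `∞`. -/
structure IsOrliczFunction (Φ : ℝ → ℝ) : Prop where
  map_zero : Φ 0 = 0
  continuousOn : ContinuousOn Φ (Set.Ici 0)
  monotoneOn : MonotoneOn Φ (Set.Ici 0)
  convexOn : ConvexOn ℝ (Set.Ici 0) Φ
  tendsto_atTop : Filter.Tendsto Φ Filter.atTop Filter.atTop

/-- The `Δ₂`-condition: `Φ(2t) ≤ C Φ(t)` for all `t ≥ 0` and some constant `C > 0`. -/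
def Delta2 (Φ : ℝ → ℝ) : Prop :=
  ∃ C : ℝ, 0 < C ∧ ∀ t : ℝ, 0 ≤ t → Φ (2 * t) ≤ C * Φ t

/-- `M(t,Φ) = sup_{s>0} Φ(ts)/Φ(s)`. -/
noncomputable def orliczM (Φ : ℝ → ℝ) (t : ℝ) : ℝ :=
  sSup {r : ℝ | ∃ s : ℝ, 0 < s ∧ r = Φ (t * s) / Φ s}

/-- `p` and `q` are the Matuzewska–Orlicz indices of `Φ`:
`p = lim_{t→0⁺} log M(t,Φ)/log t` and `q = lim_{t→∞} log M(t,Φ)/log t`. -/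
def HasMatuzewskaOrliczIndices (Φ : ℝ → ℝ) (p q : ℝ) : Prop :=
  Filter.Tendsto (fun t : ℝ => Real.log (orliczM Φ t) / Real.log t)
      (nhdsWithin 0 (Set.Ioi 0)) (nhds p) ∧
  Filter.Tendsto (fun t : ℝ => Real.log (orliczM Φ t) / Real.log t)
      Filter.atTop (nhds q)
section Couple

variable {E : Type*} [AddCommGroup E] [Module ℝ E] [TopologicalSpace E]
variable {X₀ X₁ Z : Type*}
variable [NormedAddCommGroup X₀] [NormedSpace ℝ X₀]
variable [NormedAddCommGroup X₁] [NormedSpace ℝ X₁]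
variable [NormedAddCommGroup Z] [NormedSpace ℝ Z]

/-- `x` belongs to the sum `X₀ + X₁` of the couple (embedded in `E` via `i₀, i₁`). -/
def InSigma (i₀ : X₀ →L[ℝ] E) (i₁ : X₁ →L[ℝ] E) (x : E) : Prop :=
  ∃ a b, x = i₀ a + i₁ b

/-- `x` belongs to the intersection `X₀ ∩ X₁` of the couple. -/
def InDelta (i₀ : X₀ →L[ℝ] E) (i₁ : X₁ →L[ℝ] E) (x : E) : Prop :=
  ∃ a b, i₀ a = x ∧ i₁ b = x

/-- The K-functional of the couple: `K(t,x) = inf {‖a‖ + t‖b‖ : x = a + b}`. -/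
noncomputable def Kfun (i₀ : X₀ →L[ℝ] E) (i₁ : X₁ →L[ℝ] E) (t : ℝ) (x : E) : ℝ :=
  sInf {r : ℝ | ∃ a b, x = i₀ a + i₁ b ∧ r = ‖a‖ + t * ‖b‖}

/-- The J-functional of the couple: `J(t,x) = max (‖x‖_{X₀}, t‖x‖_{X₁})` for `x ∈ Δ`. -/
noncomputable def Jfun (i₀ : X₀ →L[ℝ] E) (i₁ : X₁ →L[ℝ] E) (t : ℝ) (x : E) : ℝ :=
  sInf {r : ℝ | ∃ a b, i₀ a = x ∧ i₁ b = x ∧ r = max ‖a‖ (t * ‖b‖)}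

/-- `Z` (embedded in `E` via `j`) is an intermediate space of the couple `(X₀, X₁)`:
the inclusions `Δ ⊆ Z ⊆ Σ` are continuous (`‖·‖_Δ = J(1,·)` and `‖·‖_Σ = K(1,·)`). -/
def IsIntermediate (i₀ : X₀ →L[ℝ] E) (i₁ : X₁ →L[ℝ] E) (j : Z →L[ℝ] E) : Prop :=
  (∃ c : ℝ, 0 < c ∧ ∀ x : E, InDelta i₀ i₁ x →
      ∃ z : Z, j z = x ∧ ‖z‖ ≤ c * Jfun i₀ i₁ 1 x) ∧
  (∃ c : ℝ, 0 < c ∧ ∀ z : Z, InSigma i₀ i₁ (j z) ∧ Kfun i₀ i₁ 1 (j z) ≤ c * ‖z‖)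

/-- `Z` belongs to the class `C_K(θ, (X₀,X₁))` with constant `C`. -/
def ClassCK (i₀ : X₀ →L[ℝ] E) (i₁ : X₁ →L[ℝ] E) (j : Z →L[ℝ] E) (θ C : ℝ) : Prop :=
  ∀ z : Z, ∀ t : ℝ, 0 < t → Kfun i₀ i₁ t (j z) ≤ C * t ^ θ * ‖z‖

/-- `Z` belongs to the class `C_J(θ, (X₀,X₁))` with constant `C`. -/
def ClassCJ (i₀ : X₀ →L[ℝ] E) (i₁ : X₁ →L[ℝ] E) (j : Z →L[ℝ] E) (θ C : ℝ) : Prop :=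
  ∀ z : Z, InDelta i₀ i₁ (j z) → ∀ t : ℝ, 0 < t →
    ‖z‖ ≤ C * t ^ (-θ) * Jfun i₀ i₁ t (j z)

end Couple

/-- `u : (0,∞) → Δ(X̄)` is a representation of `y` with respect to the couple `(X₀,X₁)`:
`u` is strongly measurable with values in `Δ`, and `y = ∫₀^∞ u(t) dt/t` with the improper
integral converging in `Σ(X̄)` (whose norm is `K(1,·)`). -/
structure IsRepresentation
    {E X₀ X₁ : Type*} [AddCommGroup E] [Module ℝ E] [TopologicalSpace E]
    [NormedAddCommGroup X₀] [NormedSpace ℝ X₀]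
    [NormedAddCommGroup X₁] [NormedSpace ℝ X₁]
    (i₀ : X₀ →L[ℝ] E) (i₁ : X₁ →L[ℝ] E) (y : E) (u : ℝ → E) : Prop where
  mem_delta : ∀ t : ℝ, 0 < t → InDelta i₀ i₁ (u t)
  meas₁ : ∃ u₁ : ℝ → X₁, (∀ t : ℝ, 0 < t → i₁ (u₁ t) = u t) ∧
    MeasureTheory.AEStronglyMeasurable u₁ (MeasureTheory.volume.restrict (Set.Ioi 0))
  repr₀ : ∃ u₀ : ℝ → X₀,
    (∀ t : ℝ, 0 < t → i₀ (u₀ t) = u t) ∧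
    MeasureTheory.AEStronglyMeasurable u₀ (MeasureTheory.volume.restrict (Set.Ioi 0)) ∧
    (∀ a b : ℝ, 0 < a → IntervalIntegrable (fun t => t⁻¹ • u₀ t) MeasureTheory.volume a b) ∧
    (∀ a b : ℝ, 0 < a → InSigma i₀ i₁ (y - i₀ (∫ t in a..b, t⁻¹ • u₀ t))) ∧
    Filter.Tendsto
      (fun ab : ℝ × ℝ => Kfun i₀ i₁ 1 (y - i₀ (∫ t in ab.1..ab.2, t⁻¹ • u₀ t)))
      ((nhdsWithin (0:ℝ) (Set.Ioi 0)) ×ˢ (Filter.atTop : Filter ℝ)) (nhds 0)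

/-- The `j`-functional of a representation `u`:
`j(s, u) = ∫_s^∞ t⁻¹ J(t, u(t)) dt/t`. -/
noncomputable def jfun {E Y₀ Y₁ : Type*} [AddCommGroup E] [Module ℝ E] [TopologicalSpace E]
    [NormedAddCommGroup Y₀] [NormedSpace ℝ Y₀]
    [NormedAddCommGroup Y₁] [NormedSpace ℝ Y₁]
    (j₀ : Y₀ →L[ℝ] E) (j₁ : Y₁ →L[ℝ] E) (u : ℝ → E) (s : ℝ) : ℝ :=
  ∫ t in Set.Ioi s, Jfun j₀ j₁ t (u t) / t ^ 2

lemma orl_nonneg {Φ : ℝ → ℝ} (hΦ : IsOrliczFunction Φ) {x : ℝ} (hx : 0 ≤ x) : 0 ≤ Φ x := by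
  have := hΦ.monotoneOn (Set.mem_Ici.2 le_rfl) (Set.mem_Ici.2 hx) hx
  rwa [hΦ.map_zero] at this

lemma orl_growth_aux {Φ : ℝ → ℝ} (hΦ : IsOrliczFunction Φ) {qΦ q' : ℝ} (h1 : 1 < qΦ)
    (hq : qΦ < q')
    (h : Filter.Tendsto (fun t : ℝ => Real.log (orliczM Φ t) / Real.log t)
      Filter.atTop (nhds qΦ)) :
    ∃ T : ℝ, 1 < T ∧ ∀ t, T ≤ t → ∀ s, 0 < s → 0 < Φ s → Φ (t * s) ≤ t ^ q' * Φ s := by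
  have h2 := h.eventually (Ioo_mem_nhds h1 hq)
  obtain ⟨T, hT⟩ := Filter.eventually_atTop.1 (h2.and (eventually_gt_atTop 1))
  refine ⟨T, (hT T le_rfl).2, fun t ht s hs hΦs => ?_⟩
  obtain ⟨⟨ha, hb⟩, ht1⟩ := hT t ht
  have hlog : 0 < Real.log t := Real.log_pos ht1
  have hM0 : 0 ≤ orliczM Φ t := by
    apply Real.sSup_nonneg
    rintro r ⟨s, hs, rfl⟩
    exact div_nonneg (orl_nonneg hΦ (by positivity)) (orl_nonneg hΦ hs.le)
  have hMne : orliczM Φ t ≠ 0 := by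
    intro h0
    rw [h0] at ha
    simp at ha
    linarith
  have hM : 0 < orliczM Φ t := lt_of_le_of_ne hM0 hMne.symm
  have hbdd : BddAbove {r : ℝ | ∃ s : ℝ, 0 < s ∧ r = Φ (t * s) / Φ s} := by
    by_contra hn
    exact hMne (Real.sSup_of_not_bddAbove hn)
  have hle : Φ (t * s) / Φ s ≤ orliczM Φ t := le_csSup hbdd ⟨s, hs, rfl⟩
  have hMle : orliczM Φ t ≤ t ^ q' := by
    rw [div_lt_iff₀ hlog] at hb
    rw [← Real.log_le_log_iff hM (by positivity), Real.log_rpow (by linarith)]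
    exact hb.le
  rw [div_le_iff₀ hΦs] at hle
  exact hle.trans (by gcongr)

lemma orl_pos {Φ : ℝ → ℝ} (hΦ : IsOrliczFunction Φ) {T M : ℝ} (hT : 1 < T)
    (h : ∀ s, 0 < s → 0 < Φ s → Φ (T * s) ≤ M * Φ s) {s : ℝ} (hs : 0 < s) : 0 < Φ s := by
  by_contra hn
  have hs0 : Φ s = 0 := le_antisymm (not_lt.1 hn) (orl_nonneg hΦ hs.le)
  set Z := {x : ℝ | 0 ≤ x ∧ Φ x = 0} with hZ
  have hbdd : BddAbove Z := by
    obtain ⟨N, hN⟩ := (hΦ.tendsto_atTop.eventually (eventually_gt_atTop 0)).exists_forall_of_atTop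
    refine ⟨N, fun x hx => ?_⟩
    by_contra hlt
    have := hN x (not_le.1 hlt).le
    linarith [hx.2]
  have hZne : Z.Nonempty := ⟨s, hs.le, hs0⟩
  have hsa : s ≤ sSup Z := le_csSup hbdd ⟨hs.le, hs0⟩
  set a := sSup Z with ha
  have ha0 : 0 < a := hs.trans_le hsa
  have hpos : ∀ x, a < x → 0 < Φ x := by
    intro x hx
    refine lt_of_le_of_ne (orl_nonneg hΦ (ha0.le.trans hx.le)) fun h0 => ?_
    have : x ≤ a := le_csSup hbdd ⟨ha0.le.trans hx.le, h0.symm⟩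
    linarith
  have hclosed : IsClosed Z := by
    have := hΦ.continuousOn.preimage_isClosed_of_isClosed isClosed_Ici (isClosed_singleton (x := (0:ℝ)))
    have e : Z = Set.Ici 0 ∩ Φ ⁻¹' {0} := by ext x; simp [hZ]
    rw [e]; exact this
  have haZ : a ∈ Z := hclosed.csSup_mem hZne hbdd
  have hTa : 0 < Φ (T * a) := hpos _ (by nlinarith)
  have hcont : Tendsto (fun x => M * Φ x) (nhdsWithin a (Set.Ioi a)) (nhds (M * Φ a)) := by
    refine Tendsto.const_mul _ ?_
    have := (hΦ.continuousOn a (Set.mem_Ici.2 ha0.le))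
    exact this.mono_left (nhdsWithin_mono _ fun x hx => ha0.le.trans (le_of_lt hx))
  have hle : Φ (T * a) ≤ M * Φ a := by
    refine ge_of_tendsto hcont ?_
    filter_upwards [self_mem_nhdsWithin] with x hx
    have hx : a < x := hx
    refine le_trans ?_ (h x (ha0.trans hx) (hpos x hx))
    have hx0 : 0 < x := ha0.trans hx
    exact hΦ.monotoneOn (Set.mem_Ici.2 (by positivity)) (Set.mem_Ici.2 (by positivity)) (by gcongr)
  rw [haZ.2] at hle
  linarith

lemma orl_growth {Φ : ℝ → ℝ} (hΦ : IsOrliczFunction Φ) {qΦ q' : ℝ} (h1 : 1 < qΦ)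
    (hq : qΦ < q')
    (h : Filter.Tendsto (fun t : ℝ => Real.log (orliczM Φ t) / Real.log t)
      Filter.atTop (nhds qΦ)) :
    ∃ K : ℝ, 0 < K ∧ ∀ t, 1 ≤ t → ∀ s, 0 ≤ s → Φ (t * s) ≤ K * t ^ q' * Φ s := by
  obtain ⟨T, hT, hg⟩ := orl_growth_aux hΦ h1 hq h
  have hpos : ∀ s, 0 < s → 0 < Φ s := fun s hs => orl_pos hΦ hT (hg T le_rfl) hs
  have hT1 : 1 ≤ T ^ q' := Real.one_le_rpow hT.le (by linarith)
  refine ⟨T ^ q', by positivity, fun t ht s hs => ?_⟩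
  rcases hs.eq_or_lt with rfl | hs
  · simp [hΦ.map_zero]
  have ht1 : 1 ≤ t ^ q' := Real.one_le_rpow ht (by linarith)
  have hp := hpos s hs
  rcases le_total T t with hTt | hTt
  · refine (hg t hTt s hs hp).trans ?_
    gcongr
    nlinarith
  · have : Φ (t * s) ≤ Φ (T * s) :=
      hΦ.monotoneOn (Set.mem_Ici.2 (by positivity)) (Set.mem_Ici.2 (by positivity)) (by gcongr)
    refine this.trans ((hg T le_rfl s hs hp).trans ?_)
    gcongr
    nlinarith

lemma orl_meas {Φ : ℝ → ℝ} (hΦ : IsOrliczFunction Φ) {α : Type*} [MeasurableSpace α]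
    {f : α → ℝ} (hf : Measurable f) (h0 : ∀ x, 0 ≤ f x) : Measurable fun x => Φ (f x) := by
  have hc : Continuous fun x : ℝ => Φ (max x 0) := by
    rw [← continuousOn_univ]
    exact hΦ.continuousOn.comp (by fun_prop) (fun x _ => Set.mem_Ici.2 (le_max_right _ _))
  have := hc.measurable.comp hf
  convert this using 2 with x
  simp [h0 x]

lemma orl_jensen {Φ : ℝ → ℝ} (hΦ : IsOrliczFunction Φ) {α : Type*} [MeasurableSpace α]
    (μ : Measure α) [IsProbabilityMeasure μ]
    {f : α → ℝ} (hf : Measurable f) (h0 : ∀ x, 0 ≤ f x) :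
    ENNReal.ofReal (Φ (∫ x, f x ∂μ)) ≤ ∫⁻ x, ENNReal.ofReal (Φ (f x)) ∂μ := by
  by_cases hfi : Integrable f μ
  swap
  · rw [integral_undef hfi, hΦ.map_zero]; simp
  have hm := orl_meas hΦ hf h0
  have hnn : ∀ x, 0 ≤ Φ (f x) := fun x => orl_nonneg hΦ (h0 x)
  by_cases hgi : Integrable (fun x => Φ (f x)) μ
  · rw [← ofReal_integral_eq_lintegral_ofReal hgi (Eventually.of_forall hnn)]
    exact ENNReal.ofReal_le_ofReal (hΦ.convexOn.map_integral_le hΦ.continuousOn isClosed_Ici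
      (Eventually.of_forall h0) hfi hgi)
  · have : ∫⁻ x, ENNReal.ofReal (Φ (f x)) ∂μ = ⊤ := by
      by_contra hne
      apply hgi
      refine ⟨hm.aestronglyMeasurable, ?_⟩
      rw [hasFiniteIntegral_iff_ofReal (Eventually.of_forall hnn)]
      exact lt_top_iff_ne_top.2 hne
    rw [this]; exact le_top

lemma orl_scale (g : ℝ → ENNReal) (hg : Measurable g) {c : ℝ} (hc : 0 < c) :
    ∫⁻ t in Set.Ioi (0:ℝ), g (t * c) = ENNReal.ofReal c⁻¹ * ∫⁻ t in Set.Ioi (0:ℝ), g t := by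
  rw [← lintegral_indicator measurableSet_Ioi, ← lintegral_indicator measurableSet_Ioi]
  have hG : Measurable ((Set.Ioi (0:ℝ)).indicator g) := hg.indicator measurableSet_Ioi
  have h1 : (Set.Ioi (0:ℝ)).indicator (fun t => g (t * c)) =
      fun t => (Set.Ioi (0:ℝ)).indicator g (t * c) := by
    ext t
    simp only [Set.indicator, Set.mem_Ioi, mul_pos_iff_of_pos_right hc]
  rw [h1, ← lintegral_map (f := (Set.Ioi (0:ℝ)).indicator g) (g := fun t => t * c) hG (by fun_prop),
    Real.map_volume_mul_right hc.ne', lintegral_smul_measure, abs_of_pos (inv_pos.2 hc)]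
  rfl

lemma orl_prob {ε : ℝ} (hε : 0 < ε) :
    IsProbabilityMeasure ((volume.restrict (Set.Ioi (1:ℝ))).withDensity
      fun r => ENNReal.ofReal (ε * r ^ (-1-ε))) := by
  constructor
  rw [withDensity_apply _ MeasurableSet.univ, Measure.restrict_univ,
    ← ofReal_integral_eq_lintegral_ofReal]
  · rw [integral_const_mul, integral_Ioi_rpow_of_lt (by linarith) one_pos]
    have : (-1 - ε + 1) = -ε := by ring
    rw [this]; simp; field_simp
  · exact (integrableOn_Ioi_rpow_of_lt (by linarith) one_pos).const_mul _
  · filter_upwards [ae_restrict_mem measurableSet_Ioi] with r hr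
    have : (0:ℝ) < r := one_pos.trans hr
    simp only [Pi.zero_apply]
    positivity

lemma orl_pointwise {Φ : ℝ → ℝ} (hΦ : IsOrliczFunction Φ) {p q θ q' K ε : ℝ}
    (hp : 1 < p) (hpq : p < q) (hθ : θ = 1/p - 1/q) (hθ0 : 0 < θ) (hε : 0 < ε) (hε1 : ε ≤ 1)
    (hK : 0 < K) (hgr : ∀ t, 1 ≤ t → ∀ s, 0 ≤ s → Φ (t * s) ≤ K * t ^ q' * Φ s)
    {J : ℝ → ℝ} (hJ : Measurable J) (hJ0 : ∀ x, 0 ≤ J x) {t : ℝ} (ht : 0 < t) :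
    ENNReal.ofReal (Φ (t ^ (-(1/q)) * ∫ s in Set.Ioi (t ^ θ), J s / s ^ 2)) ≤
    ∫⁻ r in Set.Ioi (1:ℝ), ENNReal.ofReal (ε * K * ε ^ (-q') * r ^ ((1/(q*θ) + ε) * q' - 1 - ε)) *
      ENNReal.ofReal (Φ ((t * r ^ (1/θ)) ^ (-(1/p)) * J ((t * r ^ (1/θ)) ^ θ))) := by
  set μ := (volume.restrict (Set.Ioi (1:ℝ))).withDensity
      fun r => ENNReal.ofReal (ε * r ^ (-1-ε)) with hμ
  have : IsProbabilityMeasure μ := orl_prob hε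
  have hwm : Measurable fun r : ℝ => ENNReal.ofReal (ε * r ^ (-1-ε)) := by fun_prop
  set f : ℝ → ℝ := fun r => t ^ (-(1/p)) * J (t ^ θ * r) * (|r| ^ (-1+ε) / ε) with hf
  have hfm : Measurable f := by fun_prop
  have hf0 : ∀ r, 0 ≤ f r := fun r => by
    have := hJ0 (t ^ θ * r)
    positivity
  have htθ : 0 < t ^ θ := by positivity
  have hq0 : 0 < q := by linarith
  have hexp : -(1/q) - θ = -(1/p) := by rw [hθ]; ring
  have hint : t ^ (-(1/q)) * ∫ s in Set.Ioi (t ^ θ), J s / s ^ 2 = ∫ r, f r ∂μ := by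
    have h1 := integral_comp_mul_left_Ioi' (fun s => J s / s ^ 2) 1 htθ
    rw [mul_one] at h1
    rw [← h1, hμ, integral_withDensity_eq_integral_toReal_smul hwm
      (Eventually.of_forall fun _ => ENNReal.ofReal_lt_top), smul_eq_mul, ← mul_assoc,
      ← integral_const_mul]
    refine setIntegral_congr_fun measurableSet_Ioi fun r hr => ?_
    have hr0 : (0:ℝ) < r := one_pos.trans hr
    simp only [hf, smul_eq_mul]
    rw [ENNReal.toReal_ofReal (by positivity), abs_of_pos hr0]
    have e1 : r ^ (-1-ε) * r ^ (-1+ε) = (r ^ 2)⁻¹ := by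
      rw [← Real.rpow_add hr0, ← Real.rpow_natCast, ← Real.rpow_neg hr0.le]
      congr 1; push_cast; ring
    have e2 : t ^ (-(1/p)) = t ^ (-(1/q)) * (t ^ θ)⁻¹ := by
      rw [← Real.rpow_neg ht.le, ← Real.rpow_add ht, ← hexp]; congr 1
    calc t ^ (-(1/q)) * t ^ θ * (J (t ^ θ * r) / (t ^ θ * r) ^ 2)
        = t ^ (-(1/q)) * (t ^ θ)⁻¹ * J (t ^ θ * r) * (r ^ 2)⁻¹ := by field_simp
      _ = _ := by rw [← e1, ← e2]; field_simp
  rw [hint]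
  refine (orl_jensen hΦ μ hfm hf0).trans ?_
  rw [hμ, lintegral_withDensity_eq_lintegral_mul _ hwm (orl_meas hΦ hfm hf0).ennreal_ofReal]
  refine setLIntegral_mono' measurableSet_Ioi fun r hr => ?_
  have hr1 : (1:ℝ) < r := hr
  have hr0 : (0:ℝ) < r := one_pos.trans hr
  simp only [Pi.mul_apply]
  rw [← ENNReal.ofReal_mul (by positivity), ← ENNReal.ofReal_mul (by positivity)]
  apply ENNReal.ofReal_le_ofReal
  have e3 : (t * r ^ (1/θ)) ^ θ = t ^ θ * r := by
    rw [Real.mul_rpow ht.le (by positivity), ← Real.rpow_mul hr0.le]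
    rw [one_div_mul_cancel hθ0.ne', Real.rpow_one]
  have e4 : (t * r ^ (1/θ)) ^ (-(1/p)) = t ^ (-(1/p)) * r ^ (-(1/(p*θ))) := by
    rw [Real.mul_rpow ht.le (by positivity), ← Real.rpow_mul hr0.le]
    congr 2; field_simp
  rw [e3, e4]
  set a := 1/(q*θ) + ε with ha
  have ha0 : 0 ≤ a := by positivity
  have hexp2 : -1 + ε = a + -(1/(p*θ)) := by
    have h3 : 1/(p*θ) - 1/(q*θ) = 1 := by
      have : 1/(p*θ) - 1/(q*θ) = (1/p - 1/q) / θ := by field_simp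
      rw [this, ← hθ, div_self hθ0.ne']
    rw [ha]; linarith
  have e5 : f r = (r ^ a / ε) * (t ^ (-(1/p)) * r ^ (-(1/(p*θ))) * J (t ^ θ * r)) := by
    simp only [hf]
    rw [abs_of_pos hr0, hexp2, Real.rpow_add hr0]; ring
  have hone : 1 ≤ r ^ a / ε := by
    rw [le_div_iff₀ hε]
    have := Real.one_le_rpow hr1.le ha0
    linarith
  have hs0 : 0 ≤ t ^ (-(1/p)) * r ^ (-(1/(p*θ))) * J (t ^ θ * r) := by
    have := hJ0 (t ^ θ * r)
    positivity
  have h5 := hgr _ hone _ hs0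
  rw [← e5] at h5
  have e6 : (r ^ a / ε) ^ q' = r ^ (a * q') * ε ^ (-q') := by
    rw [Real.div_rpow (by positivity) hε.le, ← Real.rpow_mul hr0.le, Real.rpow_neg hε.le]; rfl
  rw [e6] at h5
  have e7 : r ^ (a * q' - 1 - ε) = r ^ (a*q') * r ^ (-1-ε) := by
    rw [← Real.rpow_add hr0]; congr 1; ring
  rw [e7]
  refine (mul_le_mul_of_nonneg_left h5 (by positivity : 0 ≤ ε * r ^ (-1-ε))).trans (le_of_eq ?_)
  ring

lemma orl_core {Φ : ℝ → ℝ} (hΦ : IsOrliczFunction Φ) {p q θ q' K : ℝ}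
    (hp : 1 < p) (hpq : p < q) (hθ : θ = 1/p - 1/q) (hq' : 1 < q') (hq'q : q' < q)
    (hK : 0 < K) (hgr : ∀ t, 1 ≤ t → ∀ s, 0 ≤ s → Φ (t * s) ≤ K * t ^ q' * Φ s) :
    ∃ C : ℝ, 0 < C ∧ ∀ J : ℝ → ℝ, Measurable J → (∀ x, 0 ≤ J x) →
    ∫⁻ t in Set.Ioi (0:ℝ), ENNReal.ofReal (Φ (t ^ (-(1/q)) * ∫ s in Set.Ioi (t ^ θ), J s / s ^ 2))
     ≤ ENNReal.ofReal C * ∫⁻ t in Set.Ioi (0:ℝ), ENNReal.ofReal (Φ (t ^ (-(1/p)) * J (t ^ θ))) := by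
  have hθ0 : 0 < θ := by
    rw [hθ, sub_pos]; exact one_div_lt_one_div_of_lt (by linarith) hpq
  have hq0 : 0 < q := by linarith
  obtain ⟨ε, hε, hε1, hεs⟩ : ∃ ε : ℝ, 0 < ε ∧ ε ≤ 1 ∧ ε * (q' - 1) < (1 - q'/q)/θ := by
    have hpos : 0 < (1 - q'/q)/θ := by
      apply div_pos _ hθ0
      rw [sub_pos, div_lt_one hq0]; exact hq'q
    have hq1 : 0 < q' - 1 := by linarith
    refine ⟨min 1 ((1 - q'/q)/θ / (2 * (q' - 1))), lt_min one_pos (by positivity),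
      min_le_left _ _, ?_⟩
    calc _ ≤ (1 - q'/q)/θ / (2 * (q' - 1)) * (q' - 1) := by gcongr; exact min_le_right _ _
      _ = (1 - q'/q)/θ / 2 := by field_simp
      _ < _ := by linarith
  set b := (1/(q*θ) + ε) * q' - 1 - ε with hb
  set A := ε * K * ε ^ (-q') with hA
  have hA0 : 0 < A := by positivity
  have hbθ : b - 1/θ < -1 := by
    have : (1 - q'/q)/θ = 1/θ - 1/(q*θ) * q' := by field_simp
    rw [this] at hεs
    rw [hb]; linarith
  have hbn : b - 1/θ + 1 < 0 := by linarith
  refine ⟨A * (-1 / (b - 1/θ + 1)), mul_pos hA0 (div_pos_of_neg_of_neg (by norm_num) hbn), ?_⟩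
  intro J hJ hJ0
  set G : ℝ → ENNReal := fun t => ENNReal.ofReal (Φ (|t| ^ (-(1/p)) * J (t ^ θ))) with hG
  have hGm : Measurable G := by
    apply Measurable.ennreal_ofReal
    apply orl_meas hΦ
    · fun_prop
    · intro x; have := hJ0 (x ^ θ); positivity
  calc _ ≤ ∫⁻ t in Set.Ioi (0:ℝ), ∫⁻ r in Set.Ioi (1:ℝ),
        ENNReal.ofReal (A * r ^ b) * G (t * r ^ (1/θ)) := by
        refine setLIntegral_mono' measurableSet_Ioi fun t ht => ?_
        have ht : 0 < t := ht
        refine (orl_pointwise hΦ hp hpq hθ hθ0 hε hε1 hK hgr hJ hJ0 ht).trans ?_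
        refine setLIntegral_mono' measurableSet_Ioi fun r hr => ?_
        have hr0 : (0:ℝ) < r := one_pos.trans hr
        have : 0 < t * r ^ (1/θ) := by positivity
        simp only [hG, abs_of_pos this]
        exact le_rfl
    _ = ∫⁻ r in Set.Ioi (1:ℝ), ∫⁻ t in Set.Ioi (0:ℝ),
        ENNReal.ofReal (A * r ^ b) * G (t * r ^ (1/θ)) := by
        apply lintegral_lintegral_swap
        apply Measurable.aemeasurable
        change Measurable fun x : ℝ × ℝ => ENNReal.ofReal (A * x.2 ^ b) * G (x.1 * x.2 ^ (1/θ))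
        clear_value G
        fun_prop
    _ = ∫⁻ r in Set.Ioi (1:ℝ), ENNReal.ofReal (A * r ^ (b - 1/θ)) * ∫⁻ t in Set.Ioi (0:ℝ), G t := by
        refine setLIntegral_congr_fun measurableSet_Ioi fun r hr => ?_
        have hr0 : (0:ℝ) < r := one_pos.trans hr
        have hc : 0 < r ^ (1/θ) := by positivity
        have hGc : Measurable fun t : ℝ => G (t * r ^ (1/θ)) := hGm.comp (by fun_prop)
        rw [lintegral_const_mul _ hGc, orl_scale G hGm hc, ← mul_assoc,
          ← ENNReal.ofReal_mul (by positivity), Real.rpow_sub hr0 b (1/θ)]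
        congr 2; ring
    _ = ENNReal.ofReal (A * (-1 / (b - 1/θ + 1))) * ∫⁻ t in Set.Ioi (0:ℝ), G t := by
        rw [lintegral_mul_const _ (by fun_prop), ← ofReal_integral_eq_lintegral_ofReal]
        · rw [integral_const_mul, integral_Ioi_rpow_of_lt hbθ one_pos]; simp
        · exact (integrableOn_Ioi_rpow_of_lt hbθ one_pos).const_mul _
        · filter_upwards [ae_restrict_mem measurableSet_Ioi] with r hr
          have : (0:ℝ) < r := one_pos.trans hr
          simp only [Pi.zero_apply]
          positivity
    _ = _ := by
        congr 1
        refine setLIntegral_congr_fun measurableSet_Ioi fun t ht => ?_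
        have ht : 0 < t := ht
        simp only [hG, abs_of_pos ht]

lemma orl_ae_rpow {P : ℝ → Prop} {θ : ℝ} (hθ : 0 < θ)
    (h : ∀ᵐ x ∂(volume.restrict (Set.Ioi (0:ℝ))), P x) :
    ∀ᵐ t ∂(volume.restrict (Set.Ioi (0:ℝ))), P (t ^ θ) := by
  rw [ae_restrict_iff' measurableSet_Ioi, ae_iff] at h ⊢
  have hd : DifferentiableOn ℝ (fun x : ℝ => x ^ (1/θ)) {a | ¬(a ∈ Set.Ioi (0:ℝ) → P a)} := by
    intro x hx
    have hx0 : 0 < x := by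
      by_contra hn
      exact hx fun h => absurd h hn
    exact (Real.differentiableAt_rpow_const_of_ne _ hx0.ne').differentiableWithinAt
  refine measure_mono_null ?_ (addHaar_image_eq_zero_of_differentiableOn_of_addHaar_eq_zero volume hd h)
  intro t ht
  simp only [Set.mem_ofPred_eq, Classical.not_imp, Set.mem_Ioi] at ht
  refine ⟨t ^ θ, ?_, ?_⟩
  · simp only [Set.mem_ofPred_eq, Classical.not_imp, Set.mem_Ioi]
    exact ⟨Real.rpow_pos_of_pos ht.1 _, ht.2⟩
  · simp only
    rw [← Real.rpow_mul ht.1.le, mul_one_div_cancel hθ.ne', Real.rpow_one]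

/-- weighted Φ-moment comparison between the `j`-functional of a
representation `u` and the J-functional along `u`, when `1 < p < p_Φ ≤ q_Φ < q < ∞`,
with `θ = 1/p − 1/q`. -/
theorem statement8 (Φ : ℝ → ℝ) (hΦ : IsOrliczFunction Φ) (pΦ qΦ : ℝ)
    (hMO : HasMatuzewskaOrliczIndices Φ pΦ qΦ) (p q θ : ℝ)
    (hp : 1 < p) (hppΦ : p < pΦ) (hpΦqΦ : pΦ ≤ qΦ) (hqΦq : qΦ < q)
    (hθ : θ = 1/p - 1/q) :
    ∃ C : ℝ, 0 < C ∧
      ∀ (E : Type*) [AddCommGroup E] [Module ℝ E] [TopologicalSpace E] [T2Space E]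
        (Y₀ Y₁ : Type*)
        [NormedAddCommGroup Y₀] [NormedSpace ℝ Y₀] [CompleteSpace Y₀]
        [NormedAddCommGroup Y₁] [NormedSpace ℝ Y₁] [CompleteSpace Y₁]
        (j₀ : Y₀ →L[ℝ] E) (j₁ : Y₁ →L[ℝ] E),
        Function.Injective ⇑j₀ → Function.Injective ⇑j₁ →
        ∀ (y : E) (u : ℝ → E), InSigma j₀ j₁ y → IsRepresentation j₀ j₁ y u →
          (∫⁻ t in Set.Ioi (0:ℝ),
              ENNReal.ofReal (Φ (t ^ (-(1/q)) * jfun j₀ j₁ u (t ^ θ)))) ≤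
            ENNReal.ofReal C *
              ∫⁻ t in Set.Ioi (0:ℝ),
                ENNReal.ofReal (Φ (t ^ (-(1/p)) * Jfun j₀ j₁ (t ^ θ) (u (t ^ θ)))) := by
  have hpq : p < q := by linarith
  have hθ0 : 0 < θ := by
    rw [hθ, sub_pos]; exact one_div_lt_one_div_of_lt (by linarith) hpq
  obtain ⟨K, hK, hgr⟩ := orl_growth hΦ (q' := (qΦ + q) / 2) (by linarith) (by linarith) hMO.2
  obtain ⟨C, hC, hcore⟩ := orl_core hΦ hp hpq hθ (q' := (qΦ + q) / 2) (by linarith) (by linarith)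
    hK hgr
  refine ⟨C, hC, ?_⟩
  intro E _ _ _ _ Y₀ Y₁ _ _ _ _ _ _ j₀ j₁ hj₀ hj₁ y u _ hu
  obtain ⟨u₁, hu₁, hm₁⟩ := hu.meas₁
  obtain ⟨u₀, hu₀, hm₀, -⟩ := hu.repr₀
  have hJ : ∀ t : ℝ, 0 < t → Jfun j₀ j₁ t (u t) = max ‖u₀ t‖ (t * ‖u₁ t‖) := by
    intro t ht
    have : {r : ℝ | ∃ a b, j₀ a = u t ∧ j₁ b = u t ∧ r = max ‖a‖ (t * ‖b‖)} =
        {max ‖u₀ t‖ (t * ‖u₁ t‖)} := by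
      ext r
      simp only [Set.mem_ofPred_eq, Set.mem_singleton_iff]
      constructor
      · rintro ⟨a, b, ha, hb, rfl⟩
        rw [hj₀ (ha.trans (hu₀ t ht).symm), hj₁ (hb.trans (hu₁ t ht).symm)]
      · rintro rfl
        exact ⟨_, _, hu₀ t ht, hu₁ t ht, rfl⟩
    unfold Jfun
    rw [this, csInf_singleton]
  have hae : AEMeasurable (fun t => max ‖u₀ t‖ (t * ‖u₁ t‖)) (volume.restrict (Set.Ioi (0:ℝ))) :=
    hm₀.norm.aemeasurable.max (aemeasurable_id.mul hm₁.norm.aemeasurable)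
  set J : ℝ → ℝ := fun t => max (hae.mk _ t) 0 with hJdef
  have hJm : Measurable J := hae.measurable_mk.max measurable_const
  have hJ0 : ∀ x, 0 ≤ J x := fun x => le_max_right _ _
  have hJae : ∀ᵐ t ∂(volume.restrict (Set.Ioi (0:ℝ))), Jfun j₀ j₁ t (u t) = J t := by
    filter_upwards [hae.ae_eq_mk, ae_restrict_mem measurableSet_Ioi] with t h1 ht
    simp only [hJdef]
    rw [hJ t ht, ← h1, max_eq_left (le_max_of_le_left (norm_nonneg _))]
  have hL : ∀ t : ℝ, 0 < t → jfun j₀ j₁ u (t ^ θ) = ∫ s in Set.Ioi (t ^ θ), J s / s ^ 2 := by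
    intro t ht
    unfold jfun
    apply integral_congr_ae
    have hsub : Set.Ioi (t ^ θ) ⊆ Set.Ioi (0:ℝ) :=
      Set.Ioi_subset_Ioi (Real.rpow_pos_of_pos ht _).le
    filter_upwards [ae_restrict_of_ae_restrict_of_subset hsub hJae] with s hs
    rw [hs]
  have hR := orl_ae_rpow hθ0 hJae
  calc _ = ∫⁻ t in Set.Ioi (0:ℝ),
        ENNReal.ofReal (Φ (t ^ (-(1/q)) * ∫ s in Set.Ioi (t ^ θ), J s / s ^ 2)) := by
        refine setLIntegral_congr_fun measurableSet_Ioi fun t ht => ?_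
        simp only [hL t ht]
    _ ≤ _ := hcore J hJm hJ0
    _ = _ := by
        congr 1
        apply lintegral_congr_ae
        filter_upwards [hR] with t ht
        rw [ht]
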